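/- arXiv:1307.6233 — 3 statements merged into one kernel-verified Lean document; each statement's English description precedes it below -/
import Mathlib

section
/- Let A and B be skew shapes. If Fsupp(A) ⊇ Fsupp(B), then rows_k(A) ⊴ rows_k(B) for all k ≥ 1, cols_ℓ(A) ⊴ cols_ℓ(B) for all ℓ ≥ 1, and rects_{k,ℓ}(A) ≤ rects_{k,ℓ}(B) for all k, ℓ ≥ 1. -/
namespace SkewPaper

open Finset

/-- A skew shape `λ/μ`, given by Young diagrams `μ ≤ λ`. -/
structure SkewShape where
  lam : YoungDiagram
  mu : YoungDiagram
  sub : mu ≤ lam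

namespace SkewShape

/-- The cells (boxes) of the skew shape `λ/μ`. -/
def cells (A : SkewShape) : Finset (ℕ × ℕ) :=
  A.lam.cells \ A.mu.cells

/-- The number of boxes of `A`. -/
def size (A : SkewShape) : ℕ := A.cells.card

end SkewShape

/-- The set of columns occupied by row `i` of the cell set `s`. -/
def rowCols (s : Finset (ℕ × ℕ)) (i : ℕ) : Finset ℕ :=
  (s.filter (fun c => c.1 = i)).image Prod.snd

/-- The set of rows occupied by column `j` of the cell set `s`. -/
def colRows (s : Finset (ℕ × ℕ)) (j : ℕ) : Finset ℕ :=
  (s.filter (fun c => c.2 = j)).image Prod.fst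

/-- `overlapRow s k i` : the number of columns occupied in common by
rows `i, i+1, …, i+k-1` of `s`. -/
def overlapRow (s : Finset (ℕ × ℕ)) (k i : ℕ) : ℕ :=
  ((rowCols s i).filter (fun j => ∀ t, t < k → j ∈ rowCols s (i + t))).card

/-- `overlapCol s l j` : the number of rows occupied in common by
columns `j, j+1, …, j+l-1` of `s`. -/
def overlapCol (s : Finset (ℕ × ℕ)) (l j : ℕ) : ℕ :=
  ((colRows s j).filter (fun i => ∀ t, t < l → i ∈ colRows s (j + t))).card

/-- `rows_k`: the partition (as the multiset of its nonzero parts) of overlaps of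
`k` consecutive rows. -/
def rowsk (s : Finset (ℕ × ℕ)) (k : ℕ) : Multiset ℕ :=
  ((s.image Prod.fst).val.map (overlapRow s k)).filter (fun m => 0 < m)

/-- `cols_l`: the partition (as the multiset of its nonzero parts) of overlaps of
`l` consecutive columns. -/
def colsk (s : Finset (ℕ × ℕ)) (l : ℕ) : Multiset ℕ :=
  ((s.image Prod.snd).val.map (overlapCol s l)).filter (fun m => 0 < m)

/-- `rects s k l`: the number of `k × l` rectangles of boxes contained inside `s`. -/
def rects (s : Finset (ℕ × ℕ)) (k l : ℕ) : ℕ :=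
  (s.filter (fun c => ∀ a, a < k → ∀ b, b < l → (c.1 + a, c.2 + b) ∈ s)).card

/-- The weakly decreasing sorted list of a multiset: the partition with those parts. -/
def sortDesc (s : Multiset ℕ) : List ℕ := (s.sort (· ≤ ·)).reverse

/-- Dominance order on partitions presented as multisets of parts:
every partial sum of the decreasing sort of `s` is at most the corresponding
partial sum for `t` (missing parts treated as `0`). -/
def Dom (s t : Multiset ℕ) : Prop :=
  ∀ j : ℕ, ((sortDesc s).take j).sum ≤ ((sortDesc t).take j).sum

/-- The conjugate (transpose) of a partition presented as a multiset of parts. -/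
def conjM (s : Multiset ℕ) : Multiset ℕ :=
  (Multiset.range s.sup).map (fun j => Multiset.card (s.filter (fun x => j < x)))

/-- A standard Young tableau of shape `A`: a bijective filling of the cells of `A`
by `1, …, |A|` which increases from left to right along rows and from top to
bottom down columns.  (Entries off the shape are normalized to `0`.) -/
structure SYT (A : SkewShape) where
  entry : ℕ × ℕ → ℕ
  zero_off : ∀ c, c ∉ A.cells → entry c = 0
  mem_range : ∀ c ∈ A.cells, entry c ∈ Finset.Icc 1 A.size
  injOn : Set.InjOn entry ↑A.cells
  row_lt : ∀ i j j', (i, j) ∈ A.cells → (i, j') ∈ A.cells → j < j' →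
    entry (i, j) < entry (i, j')
  col_lt : ∀ i i' j, (i, j) ∈ A.cells → (i', j) ∈ A.cells → i < i' →
    entry (i, j) < entry (i', j)

/-- The descent set of a standard Young tableau: those `k ∈ {1, …, n-1}` such that
`k+1` appears in a strictly lower row than `k`. -/
def SYT.descentSet {A : SkewShape} (T : SYT A) : Finset ℕ :=
  (Finset.Ico 1 A.size).filter (fun k =>
    ∃ c ∈ A.cells, ∃ c' ∈ A.cells, T.entry c = k ∧ T.entry c' = k + 1 ∧ c.1 < c'.1)

/-- The composition of `n` corresponding to a subset `D ⊆ {1, …, n-1}`: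
its partial sums are the elements of `D`. -/
def compOfSet (n : ℕ) (D : Finset ℕ) : List ℕ :=
  if n = 0 then []
  else
    let l := D.sort (· ≤ ·) ++ [n]
    List.zipWith (fun x y => x - y) l (0 :: l)

/-- The descent composition of a standard Young tableau. -/
def SYT.descentComp {A : SkewShape} (T : SYT A) : List ℕ :=
  compOfSet A.size T.descentSet

/-- The F-support of `A`: the set of descent compositions of SYT of shape `A`. -/
def Fsupp (A : SkewShape) : Set (List ℕ) :=
  {α | ∃ T : SYT A, T.descentComp = α}

/-- The number of standard Young tableaux of shape `A` with descent composition `α`. -/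
noncomputable def countSYT (A : SkewShape) (α : List ℕ) : ℕ :=
  Nat.card {T : SYT A // T.descentComp = α}

/-- `S(γ)`: the set of proper partial sums of the composition `γ`. -/
def Sset (γ : List ℕ) : Finset ℕ :=
  ((List.range (γ.length - 1)).map (fun j => (γ.take (j + 1)).sum)).toFinset

/-- `cols(α)` for a composition `α` of `n`, as a multiset: the parts of the
composition corresponding to the complement of `S(α)` in `{1, …, n-1}`. -/
def colsComp (α : List ℕ) : Multiset ℕ :=
  ↑(compOfSet α.sum ((Finset.Icc 1 (α.sum - 1)) \ Sset α))

/-- Delete the leftmost box of every nonempty row. -/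
def trimCells (s : Finset (ℕ × ℕ)) : Finset (ℕ × ℕ) :=
  s.filter (fun c => 1 ≤ c.2 ∧ (c.1, c.2 - 1) ∈ s)

/-- `s` is a ribbon whose (nonempty) rows are exactly rows `r0, …, r1`, with every
pair of adjacent rows overlapping in exactly one column. -/
def IsRibbonOn (s : Finset (ℕ × ℕ)) (r0 r1 : ℕ) : Prop :=
  r0 ≤ r1 ∧ (∀ i, (rowCols s i).Nonempty ↔ r0 ≤ i ∧ i ≤ r1) ∧
    (∀ i, r0 ≤ i → i < r1 → (rowCols s i ∩ rowCols s (i + 1)).card = 1)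

/-- `A` is a ribbon. -/
def SkewShape.IsRibbon (A : SkewShape) : Prop :=
  ∃ r0 r1, IsRibbonOn A.cells r0 r1

/-- An elongated ribbon: a ribbon all of whose rows have length at least two. -/
def ElongatedRibbon (A : SkewShape) : Prop :=
  A.IsRibbon ∧ ∀ i, (rowCols A.cells i).Nonempty → 2 ≤ (rowCols A.cells i).card

/-- A horizontal strip: at most one box in each column. -/
def IsHorizontalStrip (A : SkewShape) : Prop :=
  ∀ j, (colRows A.cells j).card ≤ 1

/-- `A` is F-multiplicity-free: distinct SYT of shape `A` have distinct descent sets. -/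
def FMultFree (A : SkewShape) : Prop :=
  ∀ T T' : SYT A, T.descentSet = T'.descentSet → T = T'

/-- The cells of a shape, viewed inside `ℤ × ℤ`. -/
def toZ (s : Finset (ℕ × ℕ)) : Finset (ℤ × ℤ) :=
  s.image (fun c => ((c.1 : ℤ), (c.2 : ℤ)))

/-- The cells of the hook `(m, 1^l)`. -/
def hookCells (m l : ℕ) : Finset (ℕ × ℕ) :=
  ((Finset.range m).image (fun j => ((0 : ℕ), j))) ∪
    ((Finset.Icc 1 l).image (fun i => (i, (0 : ℕ))))


/-! ### Cells of a skew shape -/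

lemma mem_cells_iff_row (A : SkewShape) (i j : ℕ) :
    (i, j) ∈ A.cells ↔ A.mu.rowLen i ≤ j ∧ j < A.lam.rowLen i := by
  rw [SkewShape.cells, mem_sdiff, YoungDiagram.mem_cells, YoungDiagram.mem_cells,
    YoungDiagram.mem_iff_lt_rowLen, YoungDiagram.mem_iff_lt_rowLen]
  omega

lemma mem_cells_iff_col (A : SkewShape) (i j : ℕ) :
    (i, j) ∈ A.cells ↔ A.mu.colLen j ≤ i ∧ i < A.lam.colLen j := by
  rw [SkewShape.cells, mem_sdiff, YoungDiagram.mem_cells, YoungDiagram.mem_cells,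
    YoungDiagram.mem_iff_lt_colLen, YoungDiagram.mem_iff_lt_colLen]
  omega

lemma mem_rowCols (s : Finset (ℕ × ℕ)) (i j : ℕ) : j ∈ rowCols s i ↔ (i, j) ∈ s := by
  simp [rowCols]

lemma mem_colRows (s : Finset (ℕ × ℕ)) (i j : ℕ) : i ∈ colRows s j ↔ (i, j) ∈ s := by
  simp [colRows]

/-- A rectangle lies in a skew shape iff its top-left and bottom-right boxes do. -/
lemma rectangle_subset_iff (A : SkewShape) (i j K L : ℕ) :
    (∀ a, a < K + 1 → ∀ b, b < L + 1 → (i + a, j + b) ∈ A.cells) ↔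
      (i, j) ∉ A.mu ∧ (i + K, j + L) ∈ A.lam := by
  simp only [SkewShape.cells, mem_sdiff, YoungDiagram.mem_cells]
  constructor
  · intro h
    exact ⟨(h 0 (by omega) 0 (by omega)).2, (h K (by omega) L (by omega)).1⟩
  · rintro ⟨h1, h2⟩ a ha b hb
    exact ⟨A.lam.up_left_mem (by omega) (by omega) h2,
      fun h => h1 (A.mu.up_left_mem (by omega) (by omega) h)⟩

lemma overlapRow_eq (A : SkewShape) (K i : ℕ) :
    overlapRow A.cells (K + 1) i = A.lam.rowLen (i + K) - A.mu.rowLen i := by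
  rw [overlapRow, ← Nat.card_Ico]
  congr 1
  ext j
  have h := rectangle_subset_iff A i j K 0
  rw [YoungDiagram.mem_iff_lt_rowLen, YoungDiagram.mem_iff_lt_rowLen] at h
  simp only [mem_filter, mem_rowCols, mem_Ico]
  constructor
  · rintro ⟨-, h'⟩
    have := h.1 (fun a ha b hb => by obtain rfl : b = 0 := by omega
                                     exact h' a ha)
    omega
  · intro h'
    have := h.2 (by omega)
    exact ⟨this 0 (by omega) 0 (by omega), fun t ht => this t ht 0 (by omega)⟩

lemma overlapCol_eq (A : SkewShape) (L j : ℕ) :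
    overlapCol A.cells (L + 1) j = A.lam.colLen (j + L) - A.mu.colLen j := by
  rw [overlapCol, ← Nat.card_Ico]
  congr 1
  ext i
  have h := rectangle_subset_iff A i j 0 L
  rw [YoungDiagram.mem_iff_lt_colLen, YoungDiagram.mem_iff_lt_colLen] at h
  simp only [mem_filter, mem_colRows, mem_Ico]
  constructor
  · rintro ⟨-, h'⟩
    have := h.1 (fun a ha b hb => by obtain rfl : a = 0 := by omega
                                     exact h' b hb)
    omega
  · intro h'
    have := h.2 (by omega)
    exact ⟨this 0 (by omega) 0 (by omega), fun t ht => this 0 (by omega) t ht⟩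

lemma rects_eq_sum_rows (A : SkewShape) (K L : ℕ) :
    rects A.cells (K + 1) (L + 1) =
      ∑ i ∈ A.cells.image Prod.fst, (overlapRow A.cells (K + 1) i - L) := by
  rw [rects, card_eq_sum_card_fiberwise (f := Prod.fst) (t := A.cells.image Prod.fst)
    (fun c hc => mem_image_of_mem _ (mem_filter.1 hc).1)]
  refine sum_congr rfl fun i _ => ?_
  rw [overlapRow_eq, Nat.sub_right_comm, ← Nat.card_Ico,
    ← card_image_of_injective (Ico _ _) (Prod.mk_right_injective i)]
  refine congrArg card ?_
  ext ⟨i', j⟩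
  simp only [mem_filter, rectangle_subset_iff, YoungDiagram.mem_iff_lt_rowLen, mem_image, mem_Ico,
    Prod.mk.injEq]
  constructor
  · rintro ⟨⟨-, h⟩, rfl⟩
    exact ⟨j, by omega, rfl, rfl⟩
  · rintro ⟨j, h, rfl, rfl⟩
    have h' : ¬ j < A.mu.rowLen i ∧ j + L < A.lam.rowLen (i + K) := by omega
    refine ⟨⟨?_, h'⟩, rfl⟩
    have := A.lam.rowLen_anti i (i + K) (by omega)
    rw [mem_cells_iff_row]
    omega

lemma rects_eq_sum_cols (A : SkewShape) (K L : ℕ) :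
    rects A.cells (K + 1) (L + 1) =
      ∑ j ∈ A.cells.image Prod.snd, (overlapCol A.cells (L + 1) j - K) := by
  rw [rects, card_eq_sum_card_fiberwise (f := Prod.snd) (t := A.cells.image Prod.snd)
    (fun c hc => mem_image_of_mem _ (mem_filter.1 hc).1)]
  refine sum_congr rfl fun j _ => ?_
  rw [overlapCol_eq, Nat.sub_right_comm, ← Nat.card_Ico,
    ← card_image_of_injective (Ico _ _) (Prod.mk_left_injective j)]
  refine congrArg card ?_
  ext ⟨i, j'⟩
  simp only [mem_filter, rectangle_subset_iff, YoungDiagram.mem_iff_lt_colLen, mem_image, mem_Ico,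
    Prod.mk.injEq]
  constructor
  · rintro ⟨⟨-, h⟩, rfl⟩
    exact ⟨i, by omega, rfl, rfl⟩
  · rintro ⟨i, h, rfl, rfl⟩
    have h' : ¬ i < A.mu.colLen j ∧ i + K < A.lam.colLen (j + L) := by omega
    refine ⟨⟨?_, h'⟩, rfl⟩
    have := A.lam.colLen_anti j (j + L) (by omega)
    rw [mem_cells_iff_col]
    omega

/-! ### Dominance from truncated sums -/

lemma sum_map_tsub_filter_pos (s : Multiset ℕ) (c : ℕ) :
    ((s.filter (fun m => 0 < m)).map (fun x => x - c)).sum = (s.map (fun x => x - c)).sum := by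
  induction s using Multiset.induction_on with
  | empty => simp
  | cons a s ih =>
    rcases Nat.eq_zero_or_pos a with rfl | h
    · simpa using ih
    · rw [Multiset.filter_cons_of_pos (p := fun m => 0 < m) _ h]
      simp [ih]

lemma rects_eq_sum_rowsk (A : SkewShape) (K L : ℕ) :
    rects A.cells (K + 1) (L + 1) =
      ((rowsk A.cells (K + 1)).map (fun x => x - L)).sum := by
  rw [rowsk, sum_map_tsub_filter_pos, Multiset.map_map, rects_eq_sum_rows]
  rfl

lemma rects_eq_sum_colsk (A : SkewShape) (K L : ℕ) :
    rects A.cells (K + 1) (L + 1) =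
      ((colsk A.cells (L + 1)).map (fun x => x - K)).sum := by
  rw [colsk, sum_map_tsub_filter_pos, Multiset.map_map, rects_eq_sum_cols]
  rfl

lemma sum_map_sortDesc (s : Multiset ℕ) (f : ℕ → ℕ) :
    ((sortDesc s).map f).sum = (s.map f).sum := by
  conv_rhs => rw [← Multiset.sort_eq s (· ≤ ·)]
  rw [Multiset.map_coe, Multiset.sum_coe, sortDesc, List.map_reverse, List.sum_reverse]

lemma pairwise_sortDesc (s : Multiset ℕ) : (sortDesc s).Pairwise (· ≥ ·) := by
  rw [sortDesc, List.pairwise_reverse]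
  exact s.pairwise_sort (· ≤ ·)

lemma sum_le_sum_tsub_add (l : List ℕ) (c : ℕ) :
    l.sum ≤ (l.map (fun x => x - c)).sum + l.length * c := by
  induction l with
  | nil => simp
  | cons a l ih =>
    simp only [List.sum_cons, List.map_cons, List.length_cons, add_mul]
    omega

lemma sum_tsub_add_eq (l : List ℕ) (c : ℕ) (h : ∀ x ∈ l, c ≤ x) :
    (l.map (fun x => x - c)).sum + l.length * c = l.sum := by
  induction l with
  | nil => simp
  | cons a l ih =>
    have h1 := ih fun x hx => h x (List.mem_cons_of_mem _ hx)
    have h2 := h a List.mem_cons_self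
    simp only [List.sum_cons, List.map_cons, List.length_cons, add_mul]
    omega

lemma sum_map_take_le (l : List ℕ) (f : ℕ → ℕ) (j : ℕ) :
    ((l.take j).map f).sum ≤ (l.map f).sum := by
  conv_rhs => rw [← List.take_append_drop j l, List.map_append, List.sum_append]
  exact Nat.le_add_right _ _

lemma dom_of_sum_tsub_le (s t : Multiset ℕ)
    (h : ∀ c, (s.map (fun x => x - c)).sum ≤ (t.map (fun x => x - c)).sum) : Dom s t := by
  intro j
  simp only [← sum_map_sortDesc] at h
  have ht := pairwise_sortDesc t
  generalize sortDesc s = a at *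
  generalize sortDesc t = b at *
  rcases le_or_gt b.length j with hj | hj
  · have h0 := h 0
    have h1 := sum_map_take_le a (fun x => x - 0) j
    rw [List.take_of_length_le hj]
    simp only [Nat.sub_zero, List.map_id'] at h0 h1
    omega
  · set c := b[j] with hc
    have hb : b = b.take j ++ b.drop j := (List.take_append_drop j b).symm
    have htake : ∀ x ∈ b.take j, c ≤ x := by
      intro x hx
      rw [hb, List.pairwise_append] at ht
      refine ht.2.2 x hx c ?_
      rw [List.drop_eq_getElem_cons hj]
      exact List.mem_cons_self
    have hdrop : ((b.drop j).map (fun x => x - c)).sum = 0 := by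
      rw [List.sum_eq_zero_iff]
      intro y hy
      obtain ⟨x, hx, rfl⟩ := List.mem_map.1 hy
      rw [hb, List.pairwise_append, List.drop_eq_getElem_cons hj, List.pairwise_cons] at ht
      rw [List.drop_eq_getElem_cons hj, List.mem_cons] at hx
      rcases hx with rfl | hx
      · simp [hc]
      · exact Nat.sub_eq_zero_of_le (ht.2.1.1 x hx)
    have h1 := sum_le_sum_tsub_add (a.take j) c
    have h2 := sum_map_take_le a (fun x => x - c) j
    have h3 := sum_tsub_add_eq (b.take j) c htake
    have h4 := h c
    rw [hb, List.map_append, List.sum_append, hdrop] at h4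
    have h5 : (a.take j).length * c ≤ (b.take j).length * c := by
      apply Nat.mul_le_mul_right
      rw [List.length_take, List.length_take]
      omega
    omega

/-! ### The descent set is determined by the descent composition -/

lemma zipWith_sub_injective (l l' : List ℕ) (b : ℕ) (h : (b :: l).Pairwise (· ≤ ·))
    (h' : (b :: l').Pairwise (· ≤ ·))
    (e : List.zipWith (fun x y => x - y) l (b :: l) =
      List.zipWith (fun x y => x - y) l' (b :: l')) : l = l' := by
  induction l generalizing l' b with
  | nil => cases l' with
    | nil => rfl
    | cons x t => simp at e
  | cons x t ih => cases l' with
    | nil => simp at e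
    | cons x' t' =>
      rw [List.zipWith_cons_cons, List.zipWith_cons_cons, List.cons.injEq] at e
      rw [List.pairwise_cons] at h h'
      have h1 := h.1 x List.mem_cons_self
      have h2 := h'.1 x' List.mem_cons_self
      obtain rfl : x = x' := by omega
      rw [ih t' x h.2 h'.2 e.2]

lemma compOfSet_injective {n n' : ℕ} {D D' : Finset ℕ} (hD : D ⊆ Ico 1 n) (hD' : D' ⊆ Ico 1 n')
    (e : compOfSet n D = compOfSet n' D') : n = n' ∧ D = D' := by
  have key : ∀ (n : ℕ) (D : Finset ℕ), D ⊆ Ico 1 n →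
      (0 :: (D.sort (· ≤ ·) ++ [n])).Pairwise (· ≤ ·) := by
    intro n D hD
    refine List.pairwise_cons.2 ⟨fun _ _ => Nat.zero_le _, List.pairwise_append.2
      ⟨D.pairwise_sort _, List.pairwise_singleton _ _, fun x hx y hy => ?_⟩⟩
    rw [mem_sort] at hx
    rw [List.mem_singleton.1 hy]
    exact (mem_Ico.1 (hD hx)).2.le
  have hne : ∀ (n : ℕ) (D : Finset ℕ),
      List.zipWith (fun x y => x - y) (D.sort (· ≤ ·) ++ [n]) (0 :: (D.sort (· ≤ ·) ++ [n])) ≠ [] := by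
    intro n D h
    have := congrArg List.length h
    simp at this
  rw [compOfSet, compOfSet] at e
  split_ifs at e with h1 h2 h2
  · subst h1 h2
    simp only [Ico_eq_empty_of_le (Nat.zero_le 1), subset_empty] at hD hD'
    exact ⟨rfl, hD.trans hD'.symm⟩
  · exact absurd e.symm (hne _ _)
  · exact absurd e (hne _ _)
  · have := List.append_inj' (zipWith_sub_injective _ _ 0 (key n D hD) (key n' D' hD') e) rfl
    refine ⟨by simpa using this.2, ?_⟩
    rw [← sort_toFinset (· ≤ ·) (s := D), this.1, sort_toFinset]

/-! ### Descents of a tableau -/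

namespace SYT

variable {A : SkewShape} (T : SYT A)

lemma exists_entry_eq {m : ℕ} (hm : m ∈ Icc 1 A.size) : ∃ c ∈ A.cells, T.entry c = m := by
  have := surj_on_of_inj_on_of_card_le (s := A.cells) (t := Icc 1 A.size)
    (fun c _ => T.entry c) (fun c hc => T.mem_range c hc)
    (fun c c' hc hc' e => T.injOn hc hc' e) (by simp [SkewShape.size]) m hm
  obtain ⟨c, hc, e⟩ := this
  exact ⟨c, hc, e.symm⟩

lemma descentSet_subset : T.descentSet ⊆ Ico 1 A.size := filter_subset _ _

lemma mem_descentSet_iff {c c' : ℕ × ℕ} (hc : c ∈ A.cells) (hc' : c' ∈ A.cells)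
    (e : T.entry c' = T.entry c + 1) : T.entry c ∈ T.descentSet ↔ c.1 < c'.1 := by
  have h1 := mem_Icc.1 (T.mem_range c hc)
  have h2 := mem_Icc.1 (T.mem_range c' hc')
  rw [descentSet, mem_filter, mem_Ico]
  constructor
  · rintro ⟨-, d, hd, d', hd', e1, e2, h⟩
    rwa [T.injOn hd hc e1, T.injOn hd' hc' (e2.trans e.symm)] at h
  · intro h
    exact ⟨by omega, c, hc, c', hc', rfl, e, h⟩

lemma row_le_of_forall_not_mem_descentSet {c c' : ℕ × ℕ} (hc : c ∈ A.cells) (hc' : c' ∈ A.cells)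
    (hle : T.entry c ≤ T.entry c')
    (h : ∀ m, T.entry c ≤ m → m < T.entry c' → m ∉ T.descentSet) : c'.1 ≤ c.1 := by
  obtain ⟨d, hd⟩ := Nat.exists_eq_add_of_le hle
  induction d generalizing c' with
  | zero => rw [T.injOn hc' hc hd]
  | succ d ih =>
    have h1 := mem_Icc.1 (T.mem_range c hc)
    have h2 := mem_Icc.1 (T.mem_range c' hc')
    obtain ⟨e, he, hee⟩ := T.exists_entry_eq (m := T.entry c + d) (mem_Icc.2 (by omega))
    have h3 := ih he (by omega) (fun m hm hm' => h m hm (by omega)) hee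
    have h4 := h (T.entry e) (by omega) (by omega)
    rw [T.mem_descentSet_iff he hc' (by omega)] at h4
    omega

lemma row_lt_of_forall_mem_descentSet {c c' : ℕ × ℕ} (hc : c ∈ A.cells) (hc' : c' ∈ A.cells)
    (hlt : T.entry c < T.entry c')
    (h : ∀ m, T.entry c ≤ m → m < T.entry c' → m ∈ T.descentSet) : c.1 < c'.1 := by
  obtain ⟨d, hd⟩ := Nat.exists_eq_add_of_lt hlt
  induction d generalizing c' with
  | zero => exact (T.mem_descentSet_iff hc hc' hd).1 (h _ le_rfl hlt)
  | succ d ih =>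
    have h1 := mem_Icc.1 (T.mem_range c hc)
    have h2 := mem_Icc.1 (T.mem_range c' hc')
    obtain ⟨e, he, hee⟩ := T.exists_entry_eq (m := T.entry c + d + 1) (mem_Icc.2 (by omega))
    have h3 := ih he (by omega) (fun m hm hm' => h m hm (by omega)) hee
    have h4 := h (T.entry e) (by omega) (by omega)
    rw [T.mem_descentSet_iff he hc' (by omega)] at h4
    omega

/-- If the entries of a tableau are cut into `K` descent-free blocks followed by `L` blocks
consisting of descents only, then every bottom-right box of a `(K+1) × (L+1)` rectangle comes
after all these blocks. -/
lemma rects_le_of_blocks (K L : ℕ) (p : ℕ → ℕ)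
    (p_zero : p 0 = 0)
    (hK : ∀ t < K, ∀ m, p t < m → m < p (t + 1) → m ∉ T.descentSet)
    (hL : ∀ t, K ≤ t → t < K + L → ∀ m, p t < m → m < p (t + 1) → m ∈ T.descentSet) :
    rects A.cells (K + 1) (L + 1) ≤ A.size - p (K + L) := by
  rw [rects, ← Nat.card_Ioc]
  have shift : ∀ c ∈ A.cells.filter (fun c => ∀ a, a < K + 1 → ∀ b, b < L + 1 →
      (c.1 + a, c.2 + b) ∈ A.cells), p (K + L) < T.entry (c.1 + K, c.2 + L) := by
    rintro ⟨i, j⟩ hc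
    have hr := (mem_filter.1 hc).2
    simp only at hr ⊢
    have down : ∀ a b, a ≤ K → b ≤ L → p a < T.entry (i + a, j + b) := by
      intro a b ha hb
      induction a with
      | zero =>
        have := mem_Icc.1 (T.mem_range _ (hr 0 (by omega) b (by omega)))
        omega
      | succ a ih =>
        by_contra! hcon
        have h0 := ih (by omega)
        have c1 := hr a (by omega) b (by omega)
        have c2 := hr (a + 1) (by omega) b (by omega)
        have h1 := T.col_lt _ _ _ c1 c2 (by omega)
        have h2 := T.row_le_of_forall_not_mem_descentSet c1 c2 h1.le
          (fun m hm hm' => hK a (by omega) m (by omega) (by omega))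
        simp only at h2
        omega
    have right : ∀ b ≤ L, p (K + b) < T.entry (i + K, j + b) := by
      intro b hb
      induction b with
      | zero => exact down K 0 le_rfl hb
      | succ b ih =>
        by_contra! hcon
        have h0 := ih (by omega)
        have c1 := hr K (by omega) b (by omega)
        have c2 := hr K (by omega) (b + 1) (by omega)
        have h1 := T.row_lt _ _ _ c1 c2 (by omega)
        have h2 := T.row_lt_of_forall_mem_descentSet c1 c2 h1
          (fun m hm hm' => hL (K + b) (by omega) (by omega) m (by omega)
            (lt_of_lt_of_le hm' hcon))
        exact lt_irrefl _ h2
    exact right L le_rfl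
  refine card_le_card_of_injOn (fun c => T.entry (c.1 + K, c.2 + L)) ?_ ?_
  · intro c hc
    have h1 := mem_Icc.1 (T.mem_range _ ((mem_filter.1 hc).2 K (by omega) L (by omega)))
    exact mem_coe.2 (mem_Ioc.2 ⟨shift c hc, h1.2⟩)
  · intro c hc c' hc' e
    have := T.injOn ((mem_filter.1 hc).2 K (by omega) L (by omega))
      ((mem_filter.1 hc').2 K (by omega) L (by omega)) e
    rw [Prod.mk.injEq] at this
    ext <;> omega

end SYT

/-! ### The extremal tableau -/

section Rank

variable {α β : Type*} [LinearOrder β] (s : Finset α) (f : α → β)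

/-- The rank of `f c` among the values of `f` on `s`, counted from `1`. -/
def rank (c : α) : ℕ := (s.filter (fun d => f d ≤ f c)).card

variable {s f}

lemma rank_lt_rank {c d : α} (hd : d ∈ s) (h : f c < f d) : rank s f c < rank s f d := by
  refine card_lt_card ((ssubset_iff_of_subset ?_).2 ⟨d, by simp [hd], by simp [h]⟩)
  intro e he
  rw [mem_filter] at he ⊢
  exact ⟨he.1, he.2.trans h.le⟩

lemma lt_of_rank_lt_rank {c d : α} (h : rank s f c < rank s f d) : f c < f d := by
  by_contra! hcon
  refine absurd h (not_lt.2 (card_le_card ?_))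
  intro e he
  rw [mem_filter] at he ⊢
  exact ⟨he.1, he.2.trans hcon⟩

lemma rank_mem_Icc {c : α} (hc : c ∈ s) : rank s f c ∈ Icc 1 s.card := by
  refine mem_Icc.2 ⟨card_pos.2 ⟨c, by simp [hc]⟩, card_filter_le _ _⟩

lemma rank_injOn (hf : Function.Injective f) : Set.InjOn (rank s f) s := by
  intro c hc d hd e
  rcases lt_trichotomy (f c) (f d) with h | h | h
  · exact absurd e (rank_lt_rank hd h).ne
  · exact hf h
  · exact absurd e (rank_lt_rank hc h).ne'

lemma rank_le_card_iff {g : α → ℕ} (hg : ∀ c d, f c ≤ f d → g c ≤ g d) {c : α} (hc : c ∈ s)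
    (t : ℕ) : rank s f c ≤ (s.filter (fun d => g d < t)).card ↔ g c < t := by
  constructor
  · intro h
    by_contra! hcon
    refine absurd h (not_le.2 (card_lt_card ((ssubset_iff_of_subset ?_).2 ⟨c, ?_, ?_⟩)))
    · intro e he
      rw [mem_filter] at he ⊢
      refine ⟨he.1, le_of_not_gt fun h' => ?_⟩
      have := hg _ _ h'.le
      omega
    · simp [hc]
    · simp [hcon]
  · intro h
    refine card_le_card fun e he => ?_
    rw [mem_filter] at he ⊢
    exact ⟨he.1, (hg _ _ he.2).trans_lt h⟩

end Rank

namespace SkewShape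

variable (A : SkewShape) (K L : ℕ)

/-- The block of a box: the top `K` boxes of each column are assigned blocks `0, …, K-1` from top to
bottom, the leftmost `L` of the remaining boxes of each row are assigned blocks
`K, …, K+L-1` from left to right, and all other boxes are in block `K+L`. -/
def block (c : ℕ × ℕ) : ℕ :=
  if c.1 < A.mu.colLen c.2 + K then c.1 - A.mu.colLen c.2
  else K + min L (c.2 - A.mu.rowLen (c.1 - K))

/-- The sort key listing boxes by blocks, left to right in each of the first `K` blocks and
top to bottom in the others. -/
def blockKey (c : ℕ × ℕ) : ℕ ×ₗ ℕ ×ₗ ℕ :=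
  toLex (A.block K L c, if A.block K L c < K then toLex (c.2, c.1) else toLex (c.1, c.2))

variable {A K L}

lemma blockKey_lt_iff (c d : ℕ × ℕ) : A.blockKey K L c < A.blockKey K L d ↔
    A.block K L c < A.block K L d ∨ A.block K L c = A.block K L d ∧
      (A.block K L c < K ∧ (c.2 < d.2 ∨ c.2 = d.2 ∧ c.1 < d.1) ∨
        K ≤ A.block K L c ∧ (c.1 < d.1 ∨ c.1 = d.1 ∧ c.2 < d.2)) := by
  rw [blockKey, blockKey, Prod.Lex.toLex_lt_toLex]
  refine or_congr_right (and_congr_right fun h => ?_)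
  simp only at h
  rw [← h]
  split_ifs with h' <;> rw [Prod.Lex.toLex_lt_toLex] <;> simp <;> omega

lemma blockKey_injective : Function.Injective (A.blockKey K L) := by
  intro c d e
  have h1 := (blockKey_lt_iff (A := A) (K := K) (L := L) c d).not.1 e.not_lt
  have h2 := (blockKey_lt_iff (A := A) (K := K) (L := L) d c).not.1 e.not_gt
  ext <;> omega

lemma block_le_of_blockKey_le (c d : ℕ × ℕ) (h : A.blockKey K L c ≤ A.blockKey K L d) :
    A.block K L c ≤ A.block K L d := by
  by_contra! hcon
  exact absurd h (not_le.2 ((blockKey_lt_iff _ _).2 (Or.inl hcon)))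

lemma blockKey_lt_right {i j j' : ℕ} (h : (i, j) ∈ A.cells) (hj : j < j') :
    A.blockKey K L (i, j) < A.blockKey K L (i, j') := by
  rw [blockKey_lt_iff]
  rw [mem_cells_iff_col] at h
  have h1 := A.mu.colLen_anti j j' hj.le
  simp only [block, true_and]
  split_ifs <;> omega

lemma blockKey_lt_down {i i' j : ℕ} (h : (i, j) ∈ A.cells) (hi : i < i') :
    A.blockKey K L (i, j) < A.blockKey K L (i', j) := by
  rw [blockKey_lt_iff]
  rw [mem_cells_iff_col] at h
  have h1 := A.mu.rowLen_anti (i - K) (i' - K) (by omega)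
  simp only [block]
  split_ifs <;> omega

variable (A K L)

/-- The tableau listing the boxes of `A` in the order of `blockKey`. -/
def blockTableau : SYT A where
  entry c := if c ∈ A.cells then rank A.cells (A.blockKey K L) c else 0
  zero_off c hc := if_neg hc
  mem_range c hc := by rw [if_pos hc]; exact rank_mem_Icc hc
  injOn c hc d hd e := by
    simp only [if_pos (mem_coe.1 hc), if_pos (mem_coe.1 hd)] at e
    exact rank_injOn blockKey_injective hc hd e
  row_lt i j j' h h' hj := by
    rw [if_pos h, if_pos h']
    exact rank_lt_rank h' (blockKey_lt_right h hj)
  col_lt i i' j h h' hi := by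
    rw [if_pos h, if_pos h']
    exact rank_lt_rank h' (blockKey_lt_down h hi)

/-- The number of boxes in the first `t` blocks. -/
def blockSum (t : ℕ) : ℕ := (A.cells.filter (fun c => A.block K L c < t)).card

variable {A K L}

lemma blockTableau_entry {c : ℕ × ℕ} (hc : c ∈ A.cells) :
    (A.blockTableau K L).entry c = rank A.cells (A.blockKey K L) c := if_pos hc

lemma blockTableau_entry_le_iff {c : ℕ × ℕ} (hc : c ∈ A.cells) (t : ℕ) :
    (A.blockTableau K L).entry c ≤ A.blockSum K L t ↔ A.block K L c < t := by
  rw [blockTableau_entry hc]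
  exact rank_le_card_iff block_le_of_blockKey_le hc t

/-- Consecutive entries strictly inside a block lie in boxes of that block. -/
lemma exists_consecutive_of_mem_block {t m : ℕ} (h1 : A.blockSum K L t < m)
    (h2 : m < A.blockSum K L (t + 1)) :
    ∃ c ∈ A.cells, ∃ d ∈ A.cells, (A.blockTableau K L).entry c = m ∧
      (A.blockTableau K L).entry d = m + 1 ∧ A.block K L c = t ∧ A.block K L d = t ∧
      A.blockKey K L c < A.blockKey K L d := by
  have h3 : A.blockSum K L (t + 1) ≤ A.size := card_filter_le _ _
  obtain ⟨c, hc, ec⟩ := (A.blockTableau K L).exists_entry_eq (m := m) (mem_Icc.2 (by omega))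
  obtain ⟨d, hd, ed⟩ := (A.blockTableau K L).exists_entry_eq (m := m + 1) (mem_Icc.2 (by omega))
  have c1 := blockTableau_entry_le_iff (K := K) (L := L) hc t
  have c2 := blockTableau_entry_le_iff (K := K) (L := L) hc (t + 1)
  have d1 := blockTableau_entry_le_iff (K := K) (L := L) hd t
  have d2 := blockTableau_entry_le_iff (K := K) (L := L) hd (t + 1)
  refine ⟨c, hc, d, hd, ec, ed, by omega, by omega, lt_of_rank_lt_rank (s := A.cells) ?_⟩
  rw [← blockTableau_entry hc, ← blockTableau_entry hd]
  omega

lemma not_mem_descentSet_blockTableau {t m : ℕ} (ht : t < K) (h1 : A.blockSum K L t < m)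
    (h2 : m < A.blockSum K L (t + 1)) : m ∉ (A.blockTableau K L).descentSet := by
  obtain ⟨⟨i, j⟩, hc, ⟨i', j'⟩, hd, rfl, ed, bc, bd, h⟩ := exists_consecutive_of_mem_block h1 h2
  rw [SYT.mem_descentSet_iff _ hc hd ed]
  rw [blockKey_lt_iff] at h
  rw [mem_cells_iff_col] at hc hd
  simp only at h ⊢
  have hj : j ≤ j' := by omega
  have h3 := A.mu.colLen_anti j j' hj
  simp only [block] at bc bd
  split_ifs at bc bd <;> omega

lemma mem_descentSet_blockTableau {t m : ℕ} (ht : K ≤ t) (ht' : t < K + L)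
    (h1 : A.blockSum K L t < m) (h2 : m < A.blockSum K L (t + 1)) :
    m ∈ (A.blockTableau K L).descentSet := by
  obtain ⟨⟨i, j⟩, hc, ⟨i', j'⟩, hd, rfl, ed, bc, bd, h⟩ := exists_consecutive_of_mem_block h1 h2
  rw [SYT.mem_descentSet_iff _ hc hd ed]
  rw [blockKey_lt_iff] at h
  simp only at h ⊢
  by_contra! hcon
  obtain ⟨rfl, hj⟩ : i = i' ∧ j < j' := by omega
  have key : ∀ x, (i, x) ∈ A.cells → A.block K L (i, x) = t →
      A.mu.rowLen (i - K) ≤ x ∧ x = A.mu.rowLen (i - K) + (t - K) := by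
    intro x hx e
    rw [mem_cells_iff_col] at hx
    simp only [block] at e
    split_ifs at e with h'
    · omega
    · have hnot : (i - K, x) ∉ A.mu := by
        rw [YoungDiagram.mem_iff_lt_colLen]
        omega
      rw [YoungDiagram.mem_iff_lt_rowLen] at hnot
      omega
  have k1 := key j hc bc
  have k2 := key j' hd bd
  omega

lemma size_sub_blockSum_le_rects :
    A.size - A.blockSum K L (K + L) ≤ rects A.cells (K + 1) (L + 1) := by
  have h := card_filter_add_card_filter_not (s := A.cells) (fun c => A.block K L c < K + L)
  rw [size, blockSum, ← h, Nat.add_sub_cancel_left, rects]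
  have key : ∀ c ∈ A.cells.filter (fun c => ¬ A.block K L c < K + L),
      K ≤ c.1 ∧ L ≤ c.2 ∧ c ∈ A.lam ∧ (c.1 - K, c.2 - L) ∉ A.mu := by
    rintro ⟨i, j⟩ hc
    rw [mem_filter] at hc
    obtain ⟨hc, hb⟩ := hc
    have hm := (mem_cells_iff_col _ _ _).1 hc
    simp only [block] at hb
    split_ifs at hb with h'
    · omega
    · have hnot : (i - K, j) ∉ A.mu := by
        rw [YoungDiagram.mem_iff_lt_colLen]
        omega
      rw [YoungDiagram.mem_iff_lt_rowLen] at hnot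
      simp only [YoungDiagram.mem_iff_lt_rowLen (i := i - K)]
      refine ⟨by omega, by omega, ?_, by omega⟩
      rw [YoungDiagram.mem_iff_lt_colLen]
      exact hm.2
  refine card_le_card_of_injOn (fun c => (c.1 - K, c.2 - L)) ?_ ?_
  · intro c hc
    obtain ⟨h1, h2, h3, h4⟩ := key c hc
    have hr := (rectangle_subset_iff A (c.1 - K) (c.2 - L) K L).2
      ⟨h4, by rwa [Nat.sub_add_cancel h1, Nat.sub_add_cancel h2]⟩
    exact mem_coe.2 (mem_filter.2 ⟨hr 0 (by omega) 0 (by omega), hr⟩)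
  · intro c hc d hd e
    obtain ⟨h1, h2, -⟩ := key c hc
    obtain ⟨h3, h4, -⟩ := key d hd
    rw [Prod.mk.injEq] at e
    ext <;> omega

end SkewShape

lemma rects_le_of_Fsupp_subset (A B : SkewShape) (h : Fsupp B ⊆ Fsupp A) (K L : ℕ) :
    rects A.cells (K + 1) (L + 1) ≤ rects B.cells (K + 1) (L + 1) := by
  obtain ⟨T, hT⟩ := h ⟨B.blockTableau K L, rfl⟩
  obtain ⟨hn, hD⟩ := compOfSet_injective T.descentSet_subset (SYT.descentSet_subset _) hT
  refine le_trans ?_ (SkewShape.size_sub_blockSum_le_rects (A := B) (K := K) (L := L))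
  rw [← hn]
  refine T.rects_le_of_blocks K L (B.blockSum K L) ?_ ?_ ?_
  · simp [SkewShape.blockSum]
  · intro t ht m h1 h2
    rw [hD]
    exact SkewShape.not_mem_descentSet_blockTableau ht h1 h2
  · intro t ht ht' m h1 h2
    rw [hD]
    exact SkewShape.mem_descentSet_blockTableau ht ht' h1 h2

theorem stmt0 (A B : SkewShape) (h : Fsupp B ⊆ Fsupp A) :
    (∀ k, 1 ≤ k → Dom (rowsk A.cells k) (rowsk B.cells k)) ∧
    (∀ l, 1 ≤ l → Dom (colsk A.cells l) (colsk B.cells l)) ∧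
    (∀ k l, 1 ≤ k → 1 ≤ l → rects A.cells k l ≤ rects B.cells k l) := by
  have key := rects_le_of_Fsupp_subset A B h
  refine ⟨fun k hk => ?_, fun l hl => ?_, fun k l hk hl => ?_⟩
  · obtain ⟨K, rfl⟩ := Nat.exists_eq_add_of_le' hk
    refine dom_of_sum_tsub_le _ _ fun c => ?_
    rw [← rects_eq_sum_rowsk, ← rects_eq_sum_rowsk]
    exact key K c
  · obtain ⟨L, rfl⟩ := Nat.exists_eq_add_of_le' hl
    refine dom_of_sum_tsub_le _ _ fun c => ?_
    rw [← rects_eq_sum_colsk, ← rects_eq_sum_colsk]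
    exact key c L
  · obtain ⟨K, rfl⟩ := Nat.exists_eq_add_of_le' hk
    obtain ⟨L, rfl⟩ := Nat.exists_eq_add_of_le' hl
    exact key K L

end SkewPaper
end

section
/- For every skew shape A there exists a standard Young tableau of shape A whose descent composition equals the partition cols(A)^t; in particular cols(A)^t ∈ Fsupp(A). -/
namespace SkewPaper

open Finset

theorem compOfSet_image (M : ℕ → ℕ) (R : ℕ) (h0 : M 0 = 0)
    (hM : ∀ a b, a < b → b ≤ R → M a < M b) :
    compOfSet (M R) ((Finset.Ico 1 R).image M) =
      (List.range R).map (fun r => M (r + 1) - M r) := by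
  rcases R with _ | Q
  · simp [compOfSet, h0]
  have hpos := hM 0 (Q + 1) (Nat.succ_pos Q) le_rfl
  have hsorted : ((List.range Q).map fun r => M (r + 1)).Pairwise (· < ·) := by
    rw [List.pairwise_map]
    refine List.pairwise_lt_range.imp_of_mem fun ha hb hab => ?_
    rw [List.mem_range] at ha hb
    exact hM _ _ (by omega) (by omega)
  have himage : (Finset.Ico 1 (Q + 1)).image M =
      ((List.range Q).map fun r => M (r + 1)).toFinset := by
    ext x
    simp only [Finset.mem_image, Finset.mem_Ico, List.mem_toFinset, List.mem_map, List.mem_range]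
    constructor
    · rintro ⟨a, ha, rfl⟩
      exact ⟨a - 1, by omega, by rw [Nat.sub_add_cancel ha.1]⟩
    · rintro ⟨a, ha, rfl⟩
      exact ⟨a + 1, by omega, rfl⟩
  have hsort : ((Finset.Ico 1 (Q + 1)).image M).sort (· ≤ ·) ++ [M (Q + 1)] =
      (List.range (Q + 1)).map fun r => M (r + 1) := by
    rw [himage, (List.toFinset_sort _ (hsorted.imp fun h => h.ne)).2 (hsorted.imp fun h => h.le),
      List.range_succ, List.map_append, List.map_singleton]
  have hcons : 0 :: (List.range (Q + 1)).map (fun r => M (r + 1)) =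
      (List.range (Q + 2)).map M := by
    rw [List.range_succ_eq_map (n := Q + 1), List.map_cons, h0, List.map_map]
    rfl
  rw [compOfSet, if_neg (by omega)]
  simp only [hsort, hcons]
  refine List.ext_getElem (by simp) fun i h₁ h₂ => ?_
  simp

theorem sortDesc_map_range (R : ℕ) (f : ℕ → ℕ) (hf : Antitone f) :
    sortDesc ((Multiset.range R).map f) = (List.range R).map f := by
  have hperm : List.Perm (sortDesc ((Multiset.range R).map f)) ((List.range R).map f) := by
    rw [← Multiset.coe_eq_coe, sortDesc, Multiset.coe_reverse, Multiset.sort_eq]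
    rfl
  refine hperm.eq_of_pairwise' (r := (· ≥ ·)) ?_ ?_
  · rw [sortDesc, List.pairwise_reverse]
    exact Multiset.pairwise_sort _ _
  · rw [List.pairwise_map]
    exact List.pairwise_lt_range.imp fun h => hf h.le

theorem sortDesc_conjM (s : Multiset ℕ) :
    sortDesc (conjM s) =
      (List.range s.sup).map fun r => Multiset.card (s.filter fun x => r < x) :=
  sortDesc_map_range _ _ fun _ _ h =>
    Multiset.card_le_card (Multiset.monotone_filter_right _ fun _ hx => h.trans_lt hx)

namespace SkewShape

variable (A : SkewShape)

/-- The number of boxes above `c` in its column. -/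
def level (c : ℕ × ℕ) : ℕ := c.1 - A.mu.colLen c.2

/-- The length of column `j`. -/
def height (j : ℕ) : ℕ := A.lam.colLen j - A.mu.colLen j

/-- The number of boxes of level less than `r`. -/
def countBelow (r : ℕ) : ℕ := (A.cells.filter fun c => A.level c < r).card

/-- The length of the longest column. -/
def maxHeight : ℕ := (colsk A.cells 1).sup

theorem mem_cells_iff {i j : ℕ} :
    (i, j) ∈ A.cells ↔ A.mu.colLen j ≤ i ∧ i < A.lam.colLen j := by
  rw [cells, Finset.mem_sdiff, YoungDiagram.mem_cells, YoungDiagram.mem_cells,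
    YoungDiagram.mem_iff_lt_colLen, YoungDiagram.mem_iff_lt_colLen]
  omega

variable {A}

theorem row_eq {c : ℕ × ℕ} (hc : c ∈ A.cells) : c.1 = A.level c + A.mu.colLen c.2 := by
  have := A.mem_cells_iff.1 hc
  simp only [level]
  omega

theorem level_lt_height {c : ℕ × ℕ} (hc : c ∈ A.cells) : A.level c < A.height c.2 := by
  have := A.mem_cells_iff.1 hc
  simp only [level, height]
  omega

theorem exists_cell {r j : ℕ} (h : r < A.height j) : ∃ c ∈ A.cells, A.level c = r ∧ c.2 = j := by
  refine ⟨(r + A.mu.colLen j, j), A.mem_cells_iff.2 ?_, by simp [level], rfl⟩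
  simp only [height] at h
  omega

theorem cell_ext {c d : ℕ × ℕ} (hc : c ∈ A.cells) (hd : d ∈ A.cells)
    (hl : A.level c = A.level d) (h : c.2 = d.2) : c = d :=
  Prod.ext (by rw [row_eq hc, row_eq hd, hl, h]) h

variable (A)

theorem overlapCol_one (j : ℕ) : overlapCol A.cells 1 j = A.height j := by
  have h : colRows A.cells j = Finset.Ico (A.mu.colLen j) (A.lam.colLen j) := by
    ext i
    simp [colRows, ← A.mem_cells_iff]
  rw [overlapCol, Finset.filter_true_of_mem, h, Nat.card_Ico, height]
  intro i hi t ht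
  rwa [Nat.lt_one_iff.1 ht]

theorem card_level_eq (r : ℕ) :
    (A.cells.filter fun c => A.level c = r).card =
      Multiset.card ((colsk A.cells 1).filter fun x => r < x) := by
  have h : Multiset.card ((colsk A.cells 1).filter fun x => r < x) =
      ((A.cells.image Prod.snd).filter fun j => r < A.height j).card := by
    rw [colsk, Multiset.filter_filter, Multiset.filter_map, Multiset.card_map, Finset.card_def,
      Finset.filter_val]
    congr 1
    refine Multiset.filter_congr fun j _ => ?_
    simp only [Function.comp, overlapCol_one]
    omega
  rw [h]
  refine Finset.card_bij (fun c _ => c.2) ?_ ?_ ?_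
  · intro c hc
    simp only [Finset.mem_filter] at hc ⊢
    exact ⟨Finset.mem_image_of_mem _ hc.1, hc.2 ▸ level_lt_height hc.1⟩
  · intro c hc d hd hcd
    simp only [Finset.mem_filter] at hc hd
    exact cell_ext hc.1 hd.1 (hc.2.trans hd.2.symm) hcd
  · intro j hj
    simp only [Finset.mem_filter] at hj
    obtain ⟨c, hc, hl, hcj⟩ := exists_cell hj.2
    exact ⟨c, Finset.mem_filter.2 ⟨hc, hl⟩, hcj⟩

theorem countBelow_zero : A.countBelow 0 = 0 := by simp [countBelow]

theorem countBelow_succ (r : ℕ) :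
    A.countBelow (r + 1) = A.countBelow r + (A.cells.filter fun c => A.level c = r).card := by
  rw [countBelow, countBelow, ← Finset.card_union_of_disjoint]
  · congr 1
    ext c
    simp only [Finset.mem_filter, Finset.mem_union]
    grind
  · rw [Finset.disjoint_filter]
    intro c _ h
    omega

theorem countBelow_mono : Monotone A.countBelow :=
  monotone_nat_of_le_succ fun r => by rw [countBelow_succ]; exact Nat.le_add_right _ _

variable {A}

theorem level_lt_maxHeight {c : ℕ × ℕ} (hc : c ∈ A.cells) : A.level c < A.maxHeight := by
  have h := level_lt_height hc
  refine h.trans_le (Multiset.le_sup ?_)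
  rw [colsk, Multiset.mem_filter]
  refine ⟨Multiset.mem_map.2 ⟨c.2, ?_, A.overlapCol_one c.2⟩, by omega⟩
  exact Finset.mem_image_of_mem Prod.snd hc

theorem countBelow_maxHeight : A.countBelow A.maxHeight = A.size := by
  rw [countBelow, Finset.filter_true_of_mem fun c hc => level_lt_maxHeight hc, size]

theorem countBelow_lt {a b : ℕ} (hab : a < b) (hb : b ≤ A.maxHeight) :
    A.countBelow a < A.countBelow b := by
  refine lt_of_lt_of_le ?_ (A.countBelow_mono (Nat.succ_le_of_lt hab))
  rw [Nat.succ_eq_add_one, countBelow_succ, card_level_eq, Nat.lt_add_right_iff_pos,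
    Multiset.card_pos]
  intro h
  rw [Multiset.filter_eq_nil] at h
  have : A.maxHeight ≤ a := Multiset.sup_le.2 fun x hx => not_lt.1 (h x hx)
  omega

variable (A)

/-- Boxes ordered by level, and from left to right within a level. -/
def precedes (c d : ℕ × ℕ) : Prop :=
  A.level c < A.level d ∨ A.level c = A.level d ∧ c.2 ≤ d.2

instance (c d : ℕ × ℕ) : Decidable (A.precedes c d) :=
  inferInstanceAs (Decidable (_ ∨ _))

/-- The position of `c` when the boxes are read level by level, left to right. -/
def readingRank (c : ℕ × ℕ) : ℕ := (A.cells.filter fun d => A.precedes d c).card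

variable {A}

theorem readingRank_lt {c d : ℕ × ℕ} (hd : d ∈ A.cells) (h : ¬ A.precedes d c) :
    A.readingRank c < A.readingRank d := by
  refine Finset.card_lt_card (Finset.ssubset_iff_of_subset ?_ |>.2 ⟨d, ?_, ?_⟩)
  · intro e he
    rw [Finset.mem_filter] at he ⊢
    refine ⟨he.1, ?_⟩
    have := he.2
    simp only [precedes] at *
    omega
  · exact Finset.mem_filter.2 ⟨hd, Or.inr ⟨rfl, le_rfl⟩⟩
  · exact fun hm => h (Finset.mem_filter.1 hm).2

theorem precedes_of_readingRank_le {c d : ℕ × ℕ} (hd : d ∈ A.cells)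
    (h : A.readingRank d ≤ A.readingRank c) : A.precedes d c :=
  not_not.1 fun hn => (readingRank_lt hd hn).not_ge h

theorem readingRank_injOn : Set.InjOn A.readingRank A.cells := by
  intro c hc d hd h
  have h₁ := precedes_of_readingRank_le hc h.le
  have h₂ := precedes_of_readingRank_le hd h.ge
  simp only [precedes] at h₁ h₂
  exact cell_ext hc hd (by omega) (by omega)

theorem readingRank_mem {c : ℕ × ℕ} (hc : c ∈ A.cells) :
    A.readingRank c ∈ Finset.Icc 1 A.size :=
  Finset.mem_Icc.2 ⟨Finset.card_pos.2 ⟨c, Finset.mem_filter.2 ⟨hc, Or.inr ⟨rfl, le_rfl⟩⟩⟩,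
    Finset.card_filter_le _ _⟩

theorem exists_readingRank_eq {k : ℕ} (hk : k ∈ Finset.Icc 1 A.size) :
    ∃ c ∈ A.cells, A.readingRank c = k :=
  Finset.surj_on_of_inj_on_of_card_le (fun c _ => A.readingRank c) (fun _ => readingRank_mem)
    (fun _ _ hc hd h => readingRank_injOn hc hd h) (by simp [size]) k hk
    |>.imp fun _ ⟨hc, h⟩ => ⟨hc, h.symm⟩

theorem countBelow_lt_readingRank {c : ℕ × ℕ} (hc : c ∈ A.cells) :
    A.countBelow (A.level c) < A.readingRank c := by
  refine Finset.card_lt_card (Finset.ssubset_iff_of_subset ?_ |>.2 ⟨c, ?_, ?_⟩)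
  · exact Finset.monotone_filter_right _ fun _ _ h => Or.inl h
  · exact Finset.mem_filter.2 ⟨hc, Or.inr ⟨rfl, le_rfl⟩⟩
  · simp

theorem readingRank_le_countBelow (c : ℕ × ℕ) :
    A.readingRank c ≤ A.countBelow (A.level c + 1) :=
  Finset.card_le_card <| Finset.monotone_filter_right _ fun _ _ h => by
    simp only [precedes] at h
    omega

theorem level_lt_of_col_eq {i i' j : ℕ} (h : (i, j) ∈ A.cells) (hi : i < i') :
    A.level (i, j) < A.level (i', j) := by
  have := A.mem_cells_iff.1 h
  simp only [level]
  omega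

theorem level_le_of_row_eq {i j j' : ℕ} (hj : j ≤ j') :
    A.level (i, j) ≤ A.level (i, j') := by
  have := A.mu.colLen_anti j j' hj
  simp only [level]
  omega

variable (A)

/-- The standard tableau that numbers the boxes of `A` level by level, left to right. -/
def levelTableau : SYT A where
  entry c := if c ∈ A.cells then A.readingRank c else 0
  zero_off c hc := if_neg hc
  mem_range c hc := by rw [if_pos hc]; exact readingRank_mem hc
  injOn c hc d hd h := by
    rw [Finset.mem_coe] at hc hd
    simp only [if_pos hc, if_pos hd] at h
    exact readingRank_injOn hc hd h
  row_lt i j j' h h' hj := by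
    rw [if_pos h, if_pos h']
    refine readingRank_lt h' ?_
    have := A.level_le_of_row_eq (i := i) hj.le
    simp only [precedes]
    omega
  col_lt i i' j h h' hi := by
    rw [if_pos h, if_pos h']
    refine readingRank_lt h' ?_
    have := level_lt_of_col_eq h hi
    simp only [precedes]
    omega

theorem levelTableau_entry {c : ℕ × ℕ} (hc : c ∈ A.cells) :
    A.levelTableau.entry c = A.readingRank c := if_pos hc

theorem descentSet_levelTableau :
    A.levelTableau.descentSet = (Finset.Ico 1 A.maxHeight).image A.countBelow := by
  ext k
  simp only [SYT.descentSet, Finset.mem_filter, Finset.mem_image, Finset.mem_Ico]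
  constructor
  · rintro ⟨-, c, hc, d, hd, hck, hdk, hrow⟩
    rw [levelTableau_entry A hc] at hck
    rw [levelTableau_entry A hd] at hdk
    have hcd := precedes_of_readingRank_le (c := d) hc (by omega)
    have hlevel : A.level c < A.level d := by
      rcases hcd with h | ⟨h, hcol⟩
      · exact h
      · have := A.mu.colLen_anti _ _ hcol
        rw [row_eq hc, row_eq hd] at hrow
        omega
    refine ⟨A.level d, ⟨by omega, level_lt_maxHeight hd⟩, ?_⟩
    have h₁ := A.readingRank_le_countBelow c
    have h₂ := A.countBelow_mono (Nat.succ_le_of_lt hlevel)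
    have h₃ := countBelow_lt_readingRank hd
    rw [Nat.succ_eq_add_one] at h₂
    omega
  · rintro ⟨r, ⟨hr, hrR⟩, rfl⟩
    have hpos : 0 < A.countBelow r := A.countBelow_zero ▸ countBelow_lt hr hrR.le
    have hlt : A.countBelow r < A.size := countBelow_maxHeight (A := A) ▸ countBelow_lt hrR le_rfl
    obtain ⟨c, hc, hck⟩ := exists_readingRank_eq (Finset.mem_Icc.2 ⟨hpos, hlt.le⟩)
    obtain ⟨d, hd, hdk⟩ := exists_readingRank_eq
      (Finset.mem_Icc.2 ⟨Nat.succ_pos (A.countBelow r), hlt⟩)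
    refine ⟨⟨hpos, hlt⟩, c, hc, d, hd, by rwa [levelTableau_entry A hc],
      by rwa [levelTableau_entry A hd], ?_⟩
    have hc₁ := countBelow_lt_readingRank hc
    have hc₂ := A.readingRank_le_countBelow c
    have hd₁ := countBelow_lt_readingRank hd
    have hd₂ := A.readingRank_le_countBelow d
    have hcl : A.level c < r := by
      by_contra! h
      have := A.countBelow_mono h
      omega
    have hcl' : r ≤ A.level c + 1 := by
      by_contra! h
      have := countBelow_lt h hrR.le
      omega
    have hdl : r ≤ A.level d := by
      by_contra! h
      have := A.countBelow_mono (Nat.succ_le_of_lt h)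
      rw [Nat.succ_eq_add_one] at this
      omega
    have hdl' : A.level d ≤ r := by
      by_contra! h
      have := countBelow_lt h (level_lt_maxHeight hd).le
      omega
    obtain ⟨e, he, hel, hed⟩ := exists_cell
      (show r - 1 < A.height d.2 by have := level_lt_height hd; omega)
    have he₂ := A.readingRank_le_countBelow e
    rw [hel, Nat.sub_add_cancel hr] at he₂
    have hcol : d.2 ≤ c.2 := by
      have := precedes_of_readingRank_le (c := c) he (by omega)
      simp only [precedes] at this
      omega
    have := A.mu.colLen_anti _ _ hcol
    rw [row_eq hc, row_eq hd]
    omega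

theorem descentComp_levelTableau :
    A.levelTableau.descentComp = sortDesc (conjM (colsk A.cells 1)) := by
  rw [SYT.descentComp, descentSet_levelTableau, ← countBelow_maxHeight,
    compOfSet_image _ _ A.countBelow_zero fun _ _ => countBelow_lt, sortDesc_conjM]
  refine List.map_congr_left fun r _ => ?_
  rw [countBelow_succ, Nat.add_sub_cancel_left, card_level_eq]

end SkewShape

theorem stmt6 (A : SkewShape) :
    (∃ T : SYT A, T.descentComp = sortDesc (conjM (colsk A.cells 1))) ∧
    sortDesc (conjM (colsk A.cells 1)) ∈ Fsupp A :=
  ⟨⟨A.levelTableau, A.descentComp_levelTableau⟩, A.levelTableau, A.descentComp_levelTableau⟩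

end SkewPaper
end

section
/- Let A be a skew shape and let α be a composition in Fsupp(A), i.e., α is the descent composition of some standard Young tableau of shape A. Then cols(α) ⊴ rows(A)^t in dominance order. -/
namespace SkewPaper

open Finset

/-- The partial sums `0 = p 0 < p 1 < ⋯ < p L = n` of the composition of `n` with partial sums
in `E`, where `L = #E + 1`. -/
def partialSum (n : ℕ) (E : Finset ℕ) (i : ℕ) : ℕ :=
  (0 :: (E.sort (· ≤ ·) ++ [n])).getD i 0

theorem compOfSet_eq_map {n : ℕ} (hn : n ≠ 0) (E : Finset ℕ) :
    compOfSet n E =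
      (List.range (#E + 1)).map fun i => partialSum n E (i + 1) - partialSum n E i := by
  have hlen : (E.sort (· ≤ ·) ++ [n]).length = #E + 1 := by simp
  rw [compOfSet, if_neg hn]
  simp only [partialSum]
  generalize E.sort (· ≤ ·) ++ [n] = l at hlen
  apply List.ext_getElem
  · simp [hlen]
  · intro i h₁ h₂
    have hi : i < l.length := by simp at h₁; omega
    simp [List.getD_eq_getElem?_getD, hi,
      List.getElem?_eq_getElem (show i < (0 :: l).length by simp; omega)]

theorem partialSum_last (n : ℕ) (E : Finset ℕ) : partialSum n E (#E + 1) = n := by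
  simp [partialSum, List.getD_eq_getElem?_getD]

theorem pairwise_lt_cons_sort_append {n : ℕ} (hn : n ≠ 0) {E : Finset ℕ} (hE : E ⊆ Ico 1 n) :
    (0 :: (E.sort (· ≤ ·) ++ [n])).Pairwise (· < ·) := by
  have h : ∀ x ∈ E, 1 ≤ x ∧ x < n := fun x hx => mem_Ico.1 (hE hx)
  rw [List.pairwise_cons, List.pairwise_append]
  refine ⟨?_, (E.sortedLT_sort).pairwise, by simp, ?_⟩
  · intro a ha
    rcases List.mem_append.1 ha with ha | ha
    · exact (h a (by simpa using ha)).1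
    · simp at ha; omega
  · intro a ha b hb
    have := h a (by simpa using ha)
    simp at hb; omega

theorem partialSum_lt {n : ℕ} (hn : n ≠ 0) {E : Finset ℕ} (hE : E ⊆ Ico 1 n) {i j : ℕ}
    (hij : i < j) (hj : j ≤ #E + 1) : partialSum n E i < partialSum n E j := by
  have hlen : (0 :: (E.sort (· ≤ ·) ++ [n])).length = #E + 2 := by simp
  have := List.pairwise_iff_getElem.1 (pairwise_lt_cons_sort_append hn hE) i j (by omega)
    (by omega) hij
  rw [partialSum, partialSum, List.getD_eq_getElem _ _ (by omega),
    List.getD_eq_getElem _ _ (by omega)]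
  exact this

theorem partialSum_le {n : ℕ} (hn : n ≠ 0) {E : Finset ℕ} (hE : E ⊆ Ico 1 n) {i j : ℕ}
    (hij : i ≤ j) (hj : j ≤ #E + 1) : partialSum n E i ≤ partialSum n E j := by
  rcases hij.eq_or_lt with rfl | h
  · rfl
  · exact (partialSum_lt hn hE h hj).le

theorem mem_iff_exists_partialSum {n : ℕ} {E : Finset ℕ} {m : ℕ} :
    m ∈ E ↔ ∃ j < #E, partialSum n E (j + 1) = m := by
  rw [← Finset.mem_sort (· ≤ ·) (s := E), List.mem_iff_getElem]
  simp only [Finset.length_sort, partialSum, List.getD_cons_succ]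
  constructor
  · rintro ⟨j, hj, h⟩
    refine ⟨j, hj, ?_⟩
    rw [List.getD_append _ _ _ _ (by simpa using hj),
      List.getD_eq_getElem _ _ (by simpa using hj), h]
  · rintro ⟨j, hj, h⟩
    refine ⟨j, hj, ?_⟩
    rw [List.getD_append _ _ _ _ (by simpa using hj),
      List.getD_eq_getElem _ _ (by simpa using hj)] at h
    exact h

theorem sum_take_compOfSet {n : ℕ} (hn : n ≠ 0) {E : Finset ℕ} (hE : E ⊆ Ico 1 n) {j : ℕ}
    (hj : j ≤ #E + 1) : ((compOfSet n E).take j).sum = partialSum n E j := by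
  rw [compOfSet_eq_map hn, ← List.map_take, List.take_range, min_eq_left hj]
  induction j with
  | zero => rfl
  | succ j ih =>
    rw [List.range_succ, List.map_append, List.sum_append, ih (by omega)]
    have := partialSum_lt hn hE (show j < j + 1 by omega) hj
    simp only [List.map_cons, List.map_nil, List.sum_cons, List.sum_nil]
    omega

theorem length_compOfSet {n : ℕ} (hn : n ≠ 0) (E : Finset ℕ) :
    (compOfSet n E).length = #E + 1 := by
  simp [compOfSet_eq_map hn]

theorem sum_compOfSet {n : ℕ} (hn : n ≠ 0) {E : Finset ℕ} (hE : E ⊆ Ico 1 n) :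
    (compOfSet n E).sum = n := by
  have := sum_take_compOfSet hn hE le_rfl
  rwa [← length_compOfSet hn, List.take_length, length_compOfSet hn, partialSum_last] at this

theorem Sset_compOfSet {n : ℕ} (hn : n ≠ 0) {E : Finset ℕ} (hE : E ⊆ Ico 1 n) :
    Sset (compOfSet n E) = E := by
  ext m
  rw [mem_iff_exists_partialSum (n := n) (E := E)]
  simp only [Sset, length_compOfSet hn, List.mem_toFinset, List.mem_map, List.mem_range,
    Nat.add_sub_cancel]
  refine exists_congr fun j => and_congr_right fun hj => ?_
  rw [sum_take_compOfSet hn hE (by omega)]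

theorem colsComp_compOfSet {n : ℕ} (hn : n ≠ 0) {E : Finset ℕ} (hE : E ⊆ Ico 1 n) :
    colsComp (compOfSet n E) = ↑(compOfSet n (Ico 1 n \ E)) := by
  rw [colsComp, sum_compOfSet hn hE, Sset_compOfSet hn hE]
  congr 3

/-- The sum of the `j` largest elements of an indexed family is attained on an index set of
size at most `j`. -/
theorem exists_sum_take_sortDesc {ι : Type*} (s : Finset ι) (f : ι → ℕ) (j : ℕ) :
    ∃ J ⊆ s, #J ≤ j ∧ ((sortDesc (s.val.map f)).take j).sum = ∑ i ∈ J, f i := by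
  have hsub : ((sortDesc (s.val.map f)).take j).Subperm (s.toList.map f) := by
    refine (List.take_sublist _ _).subperm.trans (List.Perm.subperm ?_)
    rw [← Multiset.coe_eq_coe, sortDesc, Multiset.coe_reverse, Multiset.sort_eq,
      ← Multiset.map_coe, Finset.coe_toList]
  obtain ⟨l, hl, hlmap⟩ := hsub
  obtain ⟨l', hl', rfl⟩ := List.sublist_map_iff.1 hlmap
  have hle : (l' : Multiset ι) ≤ s.val := by
    rw [← Finset.coe_toList]
    exact hl'.subperm
  refine ⟨⟨l', Multiset.nodup_of_le hle s.nodup⟩, fun x hx => Multiset.mem_of_le hle hx, ?_, ?_⟩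
  · have := hl.length_eq
    simp only [List.length_map, List.length_take] at this
    simp only [Finset.card_mk, Multiset.coe_card]
    omega
  · rw [Finset.sum, Multiset.map_coe, Multiset.sum_coe, hl.sum_eq]

theorem sum_take_sortDesc_conjM (s : Multiset ℕ) (j : ℕ) :
    ((sortDesc (conjM s)).take j).sum = (s.map (min j)).sum := by
  set f : ℕ → ℕ := fun k => Multiset.card (s.filter fun x => k < x) with hf
  have hsort : sortDesc (conjM s) = (List.range s.sup).map f := by
    rw [sortDesc, List.reverse_eq_iff]
    refine List.Perm.eq_of_pairwise' (r := (· ≤ ·)) (Multiset.pairwise_sort _ _) ?_ ?_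
    · rw [List.pairwise_reverse, List.pairwise_map]
      refine List.pairwise_lt_range.imp fun {a b} hab => ?_
      exact Multiset.card_le_card (Multiset.monotone_filter_right s fun x hx => hab.trans hx)
    · rw [← Multiset.coe_eq_coe, Multiset.sort_eq, Multiset.coe_reverse]
      rfl
  rw [hsort, ← List.map_take, List.take_range, ← Multiset.sum_coe, ← Multiset.map_coe]
  change (∑ k ∈ range (min j s.sup), f k) = _
  have hle : ∀ x ∈ s, x ≤ s.sup := fun x hx => Multiset.le_sup hx
  generalize s.sup = M at hle
  clear hsort
  induction s using Multiset.induction_on with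
  | empty => simp [hf]
  | cons a s ih =>
    have := ih rfl fun x hx => hle x (Multiset.mem_cons_of_mem hx)
    rw [Multiset.map_cons, Multiset.sum_cons, ← this]
    have h₁ : ∀ k, f k = (if k < a then 1 else 0) + Multiset.card (s.filter fun x => k < x) := by
      intro k
      by_cases h : k < a <;> simp [hf, h, add_comm]
    have h₂ : {k ∈ range (min j M) | k < a} = range (min j a) := by
      ext k
      have := hle a (Multiset.mem_cons_self a s)
      simp
      omega
    simp only [h₁, sum_add_distrib, sum_boole, h₂, card_range, Nat.cast_id]

theorem overlapRow_one (s : Finset (ℕ × ℕ)) (i : ℕ) : overlapRow s 1 i = #{c ∈ s | c.1 = i} := by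
  rw [overlapRow, filter_true_of_mem, rowCols, card_image_of_injOn]
  · rintro ⟨a, b⟩ h ⟨c, d⟩ h' hbd
    simp at h h' hbd
    ext <;> simp <;> omega
  · intro j hj t ht
    obtain rfl : t = 0 := by omega
    exact hj

theorem sum_take_sortDesc_conjM_rows (s : Finset (ℕ × ℕ)) (j : ℕ) :
    ((sortDesc (conjM (rowsk s 1))).take j).sum =
      ∑ i ∈ s.image Prod.fst, min j #{c ∈ s | c.1 = i} := by
  rw [sum_take_sortDesc_conjM, rowsk, Finset.sum]
  simp only [← overlapRow_one]
  generalize (s.image Prod.fst).val = u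
  induction u using Multiset.induction_on with
  | empty => simp
  | cons a u ih =>
    by_cases h : 0 < overlapRow s 1 a
    · simp [h, ih]
    · have h0 : overlapRow s 1 a = 0 := by omega
      simp [h0, ih]

theorem SYT.row_lt_of_forall_mem_descentSet_s7 {A : SkewShape} (T : SYT A) {a b : ℕ} (hab : a < b)
    (h : ∀ k, a ≤ k → k < b → k ∈ T.descentSet) {c d : ℕ × ℕ} (hc : c ∈ A.cells)
    (hd : d ∈ A.cells) (hca : T.entry c = a) (hdb : T.entry d = b) : c.1 < d.1 := by
  induction b, hab using Nat.le_induction generalizing d with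
  | base =>
    obtain ⟨-, x, hx, y, hy, hxa, hya, hxy⟩ := mem_filter.1 (h a le_rfl (by omega))
    rwa [T.injOn hc hx (hca.trans hxa.symm), T.injOn hd hy (hdb.trans hya.symm)]
  | succ b hb ih =>
    obtain ⟨-, x, hx, y, hy, hxb, hyb, hxy⟩ := mem_filter.1 (h b (by omega) (by omega))
    rw [T.injOn hd hy (hdb.trans hyb.symm)]
    exact (ih (fun k h₁ h₂ => h k h₁ (by omega)) hx hxb).trans hxy

theorem SYT.image_entry {A : SkewShape} (T : SYT A) : A.cells.image T.entry = Icc 1 A.size := by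
  refine eq_of_subset_of_card_le (image_subset_iff.2 T.mem_range) ?_
  rw [card_image_of_injOn T.injOn, Nat.card_Icc, SkewShape.size]
  omega

/-- Between consecutive partial sums of the complement of the descent set, every row of the
tableau has at most one entry. -/
theorem SYT.card_filter_entry_mem_Ioc_le_one {A : SkewShape} (T : SYT A) (hn : A.size ≠ 0)
    {i : ℕ} (hi : i < #(Ico 1 A.size \ T.descentSet) + 1) (r : ℕ) :
    #{c ∈ A.cells | c.1 = r ∧ T.entry c ∈
      Ioc (partialSum A.size (Ico 1 A.size \ T.descentSet) i)
        (partialSum A.size (Ico 1 A.size \ T.descentSet) (i + 1))} ≤ 1 := by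
  set E := Ico 1 A.size \ T.descentSet with hE
  have hsub : E ⊆ Ico 1 A.size := sdiff_subset
  have hdes : ∀ k, partialSum A.size E i < k → k < partialSum A.size E (i + 1) →
      k ∈ T.descentSet := by
    intro k h₁ h₂
    by_contra hk
    have hlast := partialSum_le hn hsub (show i + 1 ≤ #E + 1 by omega) le_rfl
    rw [partialSum_last] at hlast
    have hkE : k ∈ E := mem_sdiff.2 ⟨mem_Ico.2 ⟨by omega, by omega⟩, hk⟩
    obtain ⟨j, hj, rfl⟩ := (mem_iff_exists_partialSum (n := A.size)).1 hkE
    rcases Nat.lt_or_ge j i with h | h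
    · have := partialSum_le hn hsub (show j + 1 ≤ i by omega) (by omega)
      omega
    · have := partialSum_le hn hsub (show i + 1 ≤ j + 1 by omega) (by omega)
      omega
  rw [card_le_one]
  intro c hc d hd
  simp only [mem_filter, mem_Ioc] at hc hd
  obtain ⟨hc, hcr, hc₁, hc₂⟩ := hc
  obtain ⟨hd, hdr, hd₁, hd₂⟩ := hd
  rcases lt_trichotomy (T.entry c) (T.entry d) with h | h | h
  · have := T.row_lt_of_forall_mem_descentSet_s7 h
      (fun k h₁ h₂ => hdes k (by omega) (by omega)) hc hd rfl rfl
    omega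
  · exact T.injOn hc hd h
  · have := T.row_lt_of_forall_mem_descentSet_s7 h
      (fun k h₁ h₂ => hdes k (by omega) (by omega)) hd hc rfl rfl
    omega

theorem SYT.sum_parts_le {A : SkewShape} (T : SYT A) (hn : A.size ≠ 0) {J : Finset ℕ}
    (hJ : J ⊆ range (#(Ico 1 A.size \ T.descentSet) + 1)) :
    ∑ i ∈ J, (partialSum A.size (Ico 1 A.size \ T.descentSet) (i + 1) -
        partialSum A.size (Ico 1 A.size \ T.descentSet) i) ≤
      ∑ r ∈ A.cells.image Prod.fst, min #J #{c ∈ A.cells | c.1 = r} := by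
  have hblock := fun i hi r => T.card_filter_entry_mem_Ioc_le_one hn (i := i)
    (Finset.mem_range.1 (hJ hi)) r
  set E := Ico 1 A.size \ T.descentSet with hE
  have hsub : E ⊆ Ico 1 A.size := sdiff_subset
  set p := partialSum A.size E with hp
  set B : ℕ → Finset (ℕ × ℕ) := fun i => {c ∈ A.cells | T.entry c ∈ Ioc (p i) (p (i + 1))} with hB
  have hcard : ∀ i ∈ J, p (i + 1) - p i = #(B i) := by
    intro i hi
    have hi := Finset.mem_range.1 (hJ hi)
    rw [← Nat.card_Ioc, ← card_image_of_injOn (s := B i) (f := T.entry)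
      (T.injOn.mono fun c hc => (mem_filter.1 hc).1)]
    congr 1
    ext m
    simp only [hB, mem_image, mem_filter]
    constructor
    · intro hm
      have hlast : p (i + 1) ≤ A.size :=
        (partialSum_le hn hsub (show i + 1 ≤ #E + 1 by omega) le_rfl).trans_eq
          (partialSum_last _ _)
      have hm' := mem_Ioc.1 hm
      have : m ∈ A.cells.image T.entry := by
        rw [T.image_entry, mem_Icc]
        omega
      obtain ⟨c, hc, rfl⟩ := mem_image.1 this
      exact ⟨c, ⟨hc, hm⟩, rfl⟩
    · rintro ⟨c, ⟨-, hm⟩, rfl⟩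
      exact hm
  have hdisj : (J : Set ℕ).PairwiseDisjoint B := by
    have key : ∀ i ∈ J, ∀ j ∈ J, i < j → Disjoint (B i) (B j) := by
      intro i hi j hj hij
      have hj := Finset.mem_range.1 (hJ hj)
      have : p (i + 1) ≤ p j :=
        partialSum_le hn hsub (show i + 1 ≤ j by omega) (by omega)
      rw [disjoint_left]
      intro c hc hc'
      simp only [hB, mem_filter, mem_Ioc] at hc hc'
      omega
    intro i hi j hj hij
    rcases hij.lt_or_gt with h | h
    · exact key i hi j hj h
    · exact (key j hj i hi h).symm
  rw [sum_congr rfl hcard, ← card_biUnion hdisj,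
    card_eq_sum_card_fiberwise (f := Prod.fst) (t := A.cells.image Prod.fst)]
  · refine sum_le_sum fun r _ => le_min ?_ ?_
    · rw [filter_biUnion]
      refine card_biUnion_le.trans ?_
      rw [card_eq_sum_ones]
      refine sum_le_sum fun i hi => ?_
      refine le_trans (card_le_card fun c hc => ?_) (hblock i hi r)
      simp only [hB, mem_filter] at hc ⊢
      tauto
    · refine card_le_card fun c hc => ?_
      simp only [hB, mem_filter, mem_biUnion] at hc ⊢
      obtain ⟨⟨i, -, hc, -⟩, hr⟩ := hc
      exact ⟨hc, hr⟩
  · intro c hc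
    simp only [hB, coe_biUnion, Set.mem_iUnion, mem_coe, mem_filter] at hc
    obtain ⟨i, -, hc, -⟩ := hc
    exact mem_image_of_mem _ hc

theorem stmt7 (A : SkewShape) (α : List ℕ) (h : α ∈ Fsupp A) :
    Dom (colsComp α) (conjM (rowsk A.cells 1)) := by
  obtain ⟨T, rfl⟩ := h
  intro j
  by_cases hn : A.size = 0
  · simp [SYT.descentComp, compOfSet, hn, colsComp, sortDesc]
  have hcols : colsComp T.descentComp =
      (range (#(Ico 1 A.size \ T.descentSet) + 1)).val.map fun i =>
        partialSum A.size (Ico 1 A.size \ T.descentSet) (i + 1) -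
          partialSum A.size (Ico 1 A.size \ T.descentSet) i := by
    rw [SYT.descentComp, colsComp_compOfSet hn (E := T.descentSet) (filter_subset _ _),
      compOfSet_eq_map hn]
    rfl
  rw [hcols, sum_take_sortDesc_conjM_rows]
  obtain ⟨J, hJ, hJj, hsum⟩ := exists_sum_take_sortDesc
    (range (#(Ico 1 A.size \ T.descentSet) + 1)) (fun i =>
      partialSum A.size (Ico 1 A.size \ T.descentSet) (i + 1) -
        partialSum A.size (Ico 1 A.size \ T.descentSet) i) j
  rw [hsum]
  exact (T.sum_parts_le hn hJ).trans (sum_le_sum fun r _ => min_le_min_right _ hJj)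

end SkewPaper
end
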